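/- Let (Ω, F, P) be a probability space, let d, N ≥ 1, λ > 0, Q > 0, L ≥ 0, β ≥ 1. Let φ_1, …, φ_N be random vectors in ℝ^d with ‖φ_n‖₂ ≤ Q almost surely, define the random matrices V_0 = λ I_d and V_n = V_{n−1} + φ_n φ_nᵀ, and let ρ_1, …, ρ_N be integrable real random variables with |ρ_n| ≤ 2L almost surely. Suppose E ∈ F is an event with P(Eᶜ) ≤ 1/N such that on E, ρ_n ≤ 2Lβ‖φ_n‖_{V_{n−1}⁻¹} holds for every n, where ‖x‖_A := √(xᵀ A x). Then E[ ∑_{n=1}^N ρ_n ] ≤ 2L ( 1 + β √( 2 N d log(1 + N Q² / (λ d)) ) ). -/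

import Mathlib

open MeasureTheory
open scoped Matrix

/-- The weighted norm `‖x‖_A := √(xᵀ A x)` associated to a (positive definite) matrix `A`. -/
noncomputable def wnorm {d : ℕ} (A : Matrix (Fin d) (Fin d) ℝ) (x : Fin d → ℝ) : ℝ :=
  Real.sqrt (x ⬝ᵥ A.mulVec x)

theorem aux_step {d : ℕ} (A : Matrix (Fin d) (Fin d) ℝ) (hA : A.PosDef) (x : Fin d → ℝ) :
    (A + Matrix.vecMulVec x x).PosDef ∧ 0 ≤ x ⬝ᵥ A⁻¹.mulVec x ∧
    Real.log (A + Matrix.vecMulVec x x).det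
      = Real.log A.det + Real.log (1 + x ⬝ᵥ A⁻¹.mulVec x) := by
  have h0 : 0 ≤ x ⬝ᵥ A⁻¹.mulVec x := by
    have := hA.inv.posSemidef.dotProduct_mulVec_nonneg x
    simpa using this
  refine ⟨?_, h0, ?_⟩
  · have := Matrix.posSemidef_vecMulVec_self_star x
    exact hA.add_posSemidef (by simpa using this)
  · rw [Matrix.vecMulVec_eq Unit, Matrix.det_add_replicateCol_mul_replicateRow
      (hA.det_pos.ne'.isUnit), Real.log_mul hA.det_pos.ne']
    · congr 2
      simp [Matrix.det_unique, Matrix.mul_apply, Matrix.add_apply, dotProduct, Matrix.mulVec,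
        Finset.mul_sum, Finset.sum_mul, mul_assoc]
      try exact Finset.sum_comm
    · have : (1 + Matrix.replicateRow Unit x * A⁻¹ * Matrix.replicateCol Unit x).det
          = 1 + x ⬝ᵥ A⁻¹.mulVec x := by
        simp [Matrix.det_unique, Matrix.mul_apply, Matrix.add_apply, dotProduct, Matrix.mulVec,
          Finset.mul_sum, Finset.sum_mul, mul_assoc]
        try exact Finset.sum_comm
      rw [this]; positivity

theorem aux_seq {d : ℕ} (lam Q : ℝ) (hlam : 0 < lam) (V : ℕ → Matrix (Fin d) (Fin d) ℝ)
    (hV0 : V 0 = lam • (1 : Matrix (Fin d) (Fin d) ℝ)) (N : ℕ) (x : Fin N → Fin d → ℝ)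
    (hx : ∀ n, x n ⬝ᵥ x n ≤ Q ^ 2)
    (hVs : ∀ n : Fin N, V ((n : ℕ) + 1) = V n + Matrix.vecMulVec (x n) (x n)) :
    (V N).PosDef ∧ (V N).trace ≤ lam * d + N * Q ^ 2 ∧
    (∀ n : Fin N, 0 ≤ x n ⬝ᵥ (V n)⁻¹.mulVec (x n)) ∧
    Real.log (V N).det = d * Real.log lam
      + ∑ n : Fin N, Real.log (1 + x n ⬝ᵥ (V n)⁻¹.mulVec (x n)) := by
  induction N with
  | zero =>
    rw [hV0]
    refine ⟨Matrix.PosDef.one.smul hlam, ?_, fun n => n.elim0, ?_⟩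
    · simp [Matrix.trace_smul]
    · simp [Matrix.det_smul]
  | succ N ih =>
    obtain ⟨h1, h2, h3, h4⟩ := ih (fun n => x n.castSucc) (fun n => hx _)
      (fun n => by simpa using hVs n.castSucc)
    have hl := hVs (Fin.last N)
    simp only [Fin.val_last] at hl
    obtain ⟨g1, g2, g3⟩ := aux_step (V N) h1 (x (Fin.last N))
    rw [← hl] at g1 g3
    refine ⟨g1, ?_, ?_, ?_⟩
    · rw [hl, Matrix.trace_add, Matrix.trace_vecMulVec]
      have := hx (Fin.last N)
      push_cast
      linarith
    · intro n
      refine Fin.lastCases ?_ (fun i => ?_) n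
      · simpa using g2
      · simpa using h3 i
    · rw [g3, h4, Fin.sum_univ_castSucc]
      simp [add_assoc]

theorem aux_logdet {d : ℕ} (A : Matrix (Fin d) (Fin d) ℝ) (hA : A.PosDef) (c : ℝ) (hc : 0 < c)
    (h : A.trace ≤ d * c) : Real.log A.det ≤ d * Real.log c := by
  have hd := hA.isHermitian.det_eq_prod_eigenvalues
  have ht := hA.isHermitian.trace_eq_sum_eigenvalues
  simp only [RCLike.ofReal_real_eq_id, id_eq] at hd ht
  rw [hd, Real.log_prod (fun i _ => (hA.eigenvalues_pos i).ne')]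
  have : ∀ i ∈ Finset.univ, Real.log (hA.isHermitian.eigenvalues i)
      ≤ hA.isHermitian.eigenvalues i / c - 1 + Real.log c := by
    intro i _
    have hp := hA.eigenvalues_pos i
    have := Real.log_le_sub_one_of_pos (div_pos hp hc)
    rw [Real.log_div hp.ne' hc.ne'] at this
    linarith
  refine (Finset.sum_le_sum this).trans ?_
  rw [Finset.sum_add_distrib, Finset.sum_sub_distrib, ← Finset.sum_div, ← ht]
  have : A.trace / c ≤ d := by rwa [div_le_iff₀ hc]
  simp
  linarith

theorem aux_min (x : ℝ) (hx : 0 ≤ x) : (min 1 (Real.sqrt x)) ^ 2 ≤ 2 * Real.log (1 + x) := by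
  set y := min 1 (Real.sqrt x) with hy
  have hy0 : 0 ≤ y := le_min zero_le_one (Real.sqrt_nonneg _)
  have hy1 : y ≤ 1 := min_le_left _ _
  have hyx : y ^ 2 ≤ x := by
    calc y ^ 2 ≤ (Real.sqrt x) ^ 2 := by gcongr; exact min_le_right _ _
      _ = x := Real.sq_sqrt hx
  have h1 : Real.log (1 + y ^ 2) ≤ Real.log (1 + x) := Real.log_le_log (by positivity) (by linarith)
  have h2 := Real.one_sub_inv_le_log_of_pos (show 0 < 1 + y ^ 2 by positivity)
  have h3 : y ^ 2 / 2 ≤ 1 - (1 + y ^ 2)⁻¹ := by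
    have : 1 - (1 + y ^ 2)⁻¹ = y ^ 2 / (1 + y ^ 2) := by field_simp; ring
    rw [this]
    have : y ^ 2 ≤ 1 := by nlinarith
    gcongr; linarith
  linarith

theorem aux_sum {d : ℕ} (hd : 1 ≤ d) (lam Q : ℝ) (hlam : 0 < lam)
    (V : ℕ → Matrix (Fin d) (Fin d) ℝ)
    (hV0 : V 0 = lam • (1 : Matrix (Fin d) (Fin d) ℝ)) (N : ℕ) (x : Fin N → Fin d → ℝ)
    (hx : ∀ n, x n ⬝ᵥ x n ≤ Q ^ 2)
    (hVs : ∀ n : Fin N, V ((n : ℕ) + 1) = V n + Matrix.vecMulVec (x n) (x n)) :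
    ∑ n : Fin N, min 1 (wnorm ((V n)⁻¹) (x n))
      ≤ Real.sqrt (2 * N * d * Real.log (1 + N * Q ^ 2 / (lam * d))) := by
  obtain ⟨h1, h2, h3, h4⟩ := aux_seq lam Q hlam V hV0 N x hx hVs
  have hd' : (0 : ℝ) < d := by exact_mod_cast hd
  have hpos : 0 < 1 + N * Q ^ 2 / (lam * d) := by positivity
  have h5 := aux_logdet (V N) h1 (lam * (1 + N * Q ^ 2 / (lam * d))) (by positivity)
    (h2.trans (le_of_eq (by field_simp)))
  rw [Real.log_mul hlam.ne' hpos.ne', h4] at h5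
  apply Real.le_sqrt_of_sq_le
  have h6 := sq_sum_le_card_mul_sum_sq (s := Finset.univ)
    (f := fun n : Fin N => min 1 (wnorm ((V n)⁻¹) (x n)))
  have h7 : ∑ n : Fin N, (min 1 (wnorm ((V n)⁻¹) (x n))) ^ 2
      ≤ ∑ n : Fin N, 2 * Real.log (1 + x n ⬝ᵥ (V n)⁻¹.mulVec (x n)) :=
    Finset.sum_le_sum fun n _ => aux_min _ (h3 n)
  rw [← Finset.mul_sum] at h7
  simp only [Finset.card_univ, Fintype.card_fin] at h6
  refine h6.trans ?_
  have : (N : ℝ) * ∑ n : Fin N, (min 1 (wnorm ((V n)⁻¹) (x n))) ^ 2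
      ≤ N * (2 * (d * Real.log (1 + N * Q ^ 2 / (lam * d)))) := by
    gcongr
    linarith
  linarith

/-- **core of Theorem 1.** Let `(Ω, F, P)` be a probability space,
`d, N ≥ 1`, `λ > 0`, `Q > 0`, `L ≥ 0`, `β ≥ 1`. Let `φ_1, …, φ_N` be random vectors in `ℝ^d`
with `‖φ_n‖₂ ≤ Q` a.s., define the random matrices `V_0 = λ I_d`,
`V_n = V_{n−1} + φ_n φ_nᵀ`, and let `ρ_1, …, ρ_N` be integrable real random variables with
`|ρ_n| ≤ 2L` a.s. Suppose `E` is an event with `P(Eᶜ) ≤ 1/N` such that on `E`,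
`ρ_n ≤ 2Lβ‖φ_n‖_{V_{n−1}⁻¹}` for every `n`. Then
`E[∑ n, ρ_n] ≤ 2L (1 + β √(2 N d log(1 + N Q² / (λ d))))`.
(Here `φ (n : Fin N)` is the `(n+1)`-th feature vector, so it is paired with `V n`.) -/
theorem bayesian_regret_core_bound
    {Ω : Type*} [MeasurableSpace Ω] (P : Measure Ω) [IsProbabilityMeasure P]
    (d N : ℕ) (hd : 1 ≤ d) (hN : 1 ≤ N) (lam Q L β : ℝ)
    (hlam : 0 < lam) (hQ : 0 < Q) (hL : 0 ≤ L) (hβ : 1 ≤ β)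
    (φ : Fin N → Ω → Fin d → ℝ)
    (hφ : ∀ n, ∀ᵐ ω ∂P, Real.sqrt (φ n ω ⬝ᵥ φ n ω) ≤ Q)
    (V : ℕ → Ω → Matrix (Fin d) (Fin d) ℝ)
    (hV0 : ∀ ω, V 0 ω = lam • (1 : Matrix (Fin d) (Fin d) ℝ))
    (hVs : ∀ ω, ∀ n : Fin N, V (n + 1) ω = V n ω + Matrix.vecMulVec (φ n ω) (φ n ω))
    (ρ : Fin N → Ω → ℝ) (hint : ∀ n, Integrable (ρ n) P)
    (hbd : ∀ n, ∀ᵐ ω ∂P, |ρ n ω| ≤ 2 * L)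
    (E : Set Ω) (hE : MeasurableSet E) (hEc : P Eᶜ ≤ 1 / N)
    (hregret : ∀ ω ∈ E, ∀ n : Fin N, ρ n ω ≤ 2 * L * β * wnorm ((V n ω)⁻¹) (φ n ω)) :
    ∫ ω, (∑ n, ρ n ω) ∂P ≤
      2 * L * (1 + β * Real.sqrt (2 * N * d * Real.log (1 + N * Q ^ 2 / (lam * d)))) := by
  have hae : ∀ᵐ ω ∂P, (∑ n, ρ n ω) ≤
      2 * L * β * Real.sqrt (2 * N * d * Real.log (1 + N * Q ^ 2 / (lam * d)))
        + Eᶜ.indicator (fun _ => 2 * L * N) ω := by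
    filter_upwards [ae_all_iff.2 hφ, ae_all_iff.2 hbd] with ω h1 h2
    by_cases hω : ω ∈ E
    · have hs := aux_sum hd lam Q hlam (fun n => V n ω) (hV0 ω) N (fun n => φ n ω)
        (fun n => (Real.sqrt_le_left hQ.le).1 (h1 n)) (hVs ω)
      have h3 : ∀ n ∈ Finset.univ,
          ρ n ω ≤ 2 * L * β * min 1 (wnorm ((V n ω)⁻¹) (φ n ω)) := by
        intro n _
        rcases min_choice 1 (wnorm ((V n ω)⁻¹) (φ n ω)) with h | h
        · rw [h]
          have := (le_abs_self _).trans (h2 n)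
          nlinarith
        · rw [h]; exact hregret ω hω n
      have h4 := Finset.sum_le_sum h3
      rw [← Finset.mul_sum] at h4
      have h5 : Eᶜ.indicator (fun _ => 2 * L * (N : ℝ)) ω = 0 := by simp [hω]
      rw [h5, add_zero]
      refine h4.trans ?_
      gcongr
    · have h5 : Eᶜ.indicator (fun _ => 2 * L * (N : ℝ)) ω = 2 * L * N := by simp [hω]
      rw [h5]
      have h4 : ∑ n, ρ n ω ≤ ∑ n : Fin N, 2 * L :=
        Finset.sum_le_sum fun n _ => (le_abs_self _).trans (h2 n)
      simp only [Finset.sum_const, Finset.card_univ, Fintype.card_fin, nsmul_eq_mul] at h4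
      have : 0 ≤ 2 * L * β * Real.sqrt (2 * N * d * Real.log (1 + N * Q ^ 2 / (lam * d))) := by
        positivity
      linarith
  have hI : Integrable (Eᶜ.indicator (fun _ : Ω => 2 * L * (N : ℝ))) P :=
    (integrable_const _).indicator hE.compl
  have h := integral_mono_ae (integrable_finsetSum _ fun n _ => hint n)
    ((integrable_const _).add hI) hae
  refine h.trans ?_
  simp only [Pi.add_apply]
  rw [integral_add (integrable_const _) hI, integral_indicator_const _ hE.compl]
  have hN' : (0 : ℝ) < N := by exact_mod_cast hN
  have hP : P.real Eᶜ ≤ 1 / N := by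
    have := ENNReal.toReal_mono (by simp; omega) hEc
    simpa [Measure.real] using this
  have h8 : P.real Eᶜ * (2 * L * N) ≤ 1 / N * (2 * L * N) := by gcongr
  have h9 : 1 / (N : ℝ) * (2 * L * N) = 2 * L := by field_simp
  simp only [integral_const, probReal_univ, one_smul, smul_eq_mul]
  linarith
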